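/- Let κ and n be positive integers and let N be a real number with N > n − 1. Then ( ∏_{k=1}^{n} (N − n + k) / Nⁿ ) · ∏_{k=1}^{n−1} Γ(κ(N + k) + 1) / Γ(κ(N − n + k) + 1) = ∏_{k=1}^{n−1} ∏_{l=1}^{kκ} (κ²N² − l²), where Γ is the real Gamma function. In particular the left-hand side is a polynomial in N that is even in N. -/

import Mathlib

open Real

theorem prod_Icc_one_eq_range (f : ℕ → ℝ) (n : ℕ) :
    ∏ k ∈ Finset.Icc 1 n, f k = ∏ i ∈ Finset.range n, f (i + 1) := by
  induction n with
  | zero => simp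
  | succ n ih => rw [Finset.prod_Icc_succ_top (by omega), ih, Finset.prod_range_succ]

theorem gamma_shift_aux (x : ℝ) (m : ℕ) (hx : (m : ℝ) < x) :
    Real.Gamma (x + m + 1) * (x - m) =
      Real.Gamma (x - m + 1) * x * ∏ l ∈ Finset.Icc 1 m, (x ^ 2 - (l : ℝ) ^ 2) := by
  induction m with
  | zero => simp
  | succ m ih =>
    push_cast at hx ⊢
    have hm : (0 : ℝ) ≤ m := Nat.cast_nonneg m
    have ih := ih (by linarith)
    rw [Finset.prod_Icc_succ_top (by omega)]
    have h1 : Real.Gamma (x + (m + 1) + 1) = (x + m + 1) * Real.Gamma (x + m + 1) := by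
      rw [← Real.Gamma_add_one (by linarith)]
      ring_nf
    have h2 : Real.Gamma (x - m + 1) = (x - m) * Real.Gamma (x - m) :=
      Real.Gamma_add_one (by linarith)
    have h3 : x - ((m : ℝ) + 1) + 1 = x - m := by ring
    rw [h1, h3]
    rw [h2] at ih
    have h4 : x - (m : ℝ) ≠ 0 := by linarith
    have h5 : Real.Gamma (x + m + 1) =
        Real.Gamma (x - m) * x * ∏ l ∈ Finset.Icc 1 m, (x ^ 2 - (l : ℝ) ^ 2) := by
      apply mul_right_cancel₀ h4
      rw [ih]
      ring
    rw [h5]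
    push_cast
    ring

/-- The Gamma-factor identity arising from the Morris integral normalisation of the
`n`-point correlation function of the circular β-ensemble with β = 2κ even:
`((N−n+1)_n / Nⁿ)·∏_{k=1}^{n−1} Γ(κ(N+k)+1)/Γ(κ(N−n+k)+1) = ∏_{k=1}^{n−1}∏_{l=1}^{kκ}(κ²N²−l²)`,
which in particular is an even polynomial in `N`. -/
theorem morris_gamma_factor_even_in_N (κ n : ℕ) (hκ : 0 < κ) (hn : 0 < n) (N : ℝ)
    (hN : (n : ℝ) - 1 < N) :
    ((∏ k ∈ Finset.Icc 1 n, (N - n + k)) / N ^ n) *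
        ∏ k ∈ Finset.Icc 1 (n - 1),
          Real.Gamma (κ * (N + k) + 1) / Real.Gamma (κ * (N - n + k) + 1) =
      ∏ k ∈ Finset.Icc 1 (n - 1), ∏ l ∈ Finset.Icc 1 (k * κ), ((κ : ℝ) ^ 2 * N ^ 2 - l ^ 2) := by
  obtain ⟨m, rfl⟩ : ∃ m, n = m + 1 := ⟨n - 1, by omega⟩
  have hNm : (m : ℝ) < N := by push_cast at hN; linarith
  have hm : (0 : ℝ) ≤ m := Nat.cast_nonneg m
  have hN0 : 0 < N := by linarith
  have hκ' : (0 : ℝ) < κ := by exact_mod_cast hκ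
  simp only [Nat.add_sub_cancel]
  have hA : ∏ k ∈ Finset.Icc 1 (m + 1), (N - ((m + 1 : ℕ) : ℝ) + k) =
      (∏ i ∈ Finset.range m, (N - ((i : ℝ) + 1))) * N := by
    rw [prod_Icc_one_eq_range (fun k => N - ((m + 1 : ℕ) : ℝ) + k), ← Finset.prod_range_reflect,
      Finset.prod_range_succ']
    congr 1
    · apply Finset.prod_congr rfl
      intro i hi
      have hi := Finset.mem_range.mp hi
      have : m + 1 - 1 - (i + 1) + 1 = m - i := by omega
      rw [this, Nat.cast_sub hi.le]
      push_cast
      ring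
    · simp
  have hD : ∏ i ∈ Finset.range m, Real.Gamma (κ * (N - ((m + 1 : ℕ) : ℝ) + ((i + 1 : ℕ) : ℝ)) + 1)
      = ∏ i ∈ Finset.range m, Real.Gamma (κ * (N - ((i : ℝ) + 1)) + 1) := by
    rw [← Finset.prod_range_reflect]
    apply Finset.prod_congr rfl
    intro i hi
    have hi := Finset.mem_range.mp hi
    have : m - 1 - i + 1 = m - i := by omega
    rw [this, Nat.cast_sub hi.le]
    push_cast
    ring_nf
  rw [hA, prod_Icc_one_eq_range (fun k => Real.Gamma (κ * (N + k) + 1) /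
      Real.Gamma (κ * (N - ((m + 1 : ℕ) : ℝ) + k) + 1)),
    prod_Icc_one_eq_range (fun k => ∏ l ∈ Finset.Icc 1 (k * κ), ((κ : ℝ) ^ 2 * N ^ 2 - (l : ℝ) ^ 2)),
    Finset.prod_div_distrib, hD, ← Finset.prod_div_distrib, pow_succ,
    mul_div_mul_right _ _ hN0.ne']
  have hp : N ^ m = ∏ _i ∈ Finset.range m, N := by simp
  rw [hp, ← Finset.prod_div_distrib, ← Finset.prod_mul_distrib]
  apply Finset.prod_congr rfl
  intro i hi
  have hi := Finset.mem_range.mp hi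
  have hiN : (i : ℝ) + 1 < N := by
    have : ((i + 1 : ℕ) : ℝ) ≤ m := by exact_mod_cast hi
    push_cast at this
    linarith
  have key := gamma_shift_aux (κ * N) ((i + 1) * κ) (by push_cast; nlinarith)
  push_cast at key ⊢
  have e1 : (κ : ℝ) * N + (i + 1) * κ + 1 = κ * (N + (i + 1)) + 1 := by ring
  have e2 : (κ : ℝ) * N - (i + 1) * κ + 1 = κ * (N - (i + 1)) + 1 := by ring
  rw [e1, e2] at key
  simp only [mul_pow] at key
  have hG : 0 < Real.Gamma (κ * (N - (i + 1)) + 1) := by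
    apply Real.Gamma_pos_of_pos
    have : 0 < (κ : ℝ) * (N - (i + 1)) := mul_pos hκ' (by linarith)
    linarith
  rw [div_mul_div_comm, div_eq_iff (mul_pos hN0 hG).ne']
  apply mul_left_cancel₀ hκ'.ne'
  linear_combination key
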